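/- Let C be a permutation-invariant partition of the player set of a finite normal-form game with identical interests, and let (q(t), q̄(t)) be a discrete-time ECFP process with respect to (Γ, C). Then the set of limit points of the centroid sequence {q̄(t)} is a connected, internally chain transitive set of the centroid differential inclusion ẏ ∈ BR(y) − y. -/

import Mathlib

open MeasureTheory Filter Topology

noncomputable section

namespace ECFP

variable {ι A κ : Type*}

/-- The mixed-strategy simplex over a finite action set `Y` inside the action universe `A`. -/
def simplex (Y : Finset A) : Set (A → ℝ) :=
  {p | (∀ a, 0 ≤ p a) ∧ (∀ a, a ∉ Y → p a = 0) ∧ ∑ a ∈ Y, p a = 1}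

/-- The space `Δⁿ` of joint mixed strategies. -/
def Delta (Y : ι → Finset A) : Set (ι → A → ℝ) :=
  {p | ∀ i, p i ∈ simplex (Y i)}

variable [Fintype ι] [DecidableEq ι] [Fintype A] [DecidableEq κ]

/-- The mixed extension of the common utility `u`:
`U(p₁,…,pₙ) = ∑_y u(y) p₁(y₁)⋯pₙ(yₙ)`. -/
def U (u : (ι → A) → ℝ) (p : ι → A → ℝ) : ℝ :=
  ∑ y : ι → A, u y * ∏ i, p i (y i)

/-- The `ε`-best-response set of player `i` against the joint strategy `p`
(only the components `p_{-i}` matter, since player `i`'s component is overwritten):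
`{pᵢ ∈ Δᵢ : U(pᵢ,p_{-i}) ≥ U(qᵢ,p_{-i}) - ε  ∀ qᵢ ∈ Δᵢ}`. -/
def BRi (Y : ι → Finset A) (u : (ι → A) → ℝ) (ε : ℝ) (p : ι → A → ℝ) (i : ι) :
    Set (A → ℝ) :=
  {pi | pi ∈ simplex (Y i) ∧
    ∀ qi ∈ simplex (Y i),
      U u (Function.update p i pi) ≥ U u (Function.update p i qi) - ε}

/-- The joint `ε`-best-response set `BR^ε(p) = (BR₁^ε(p_{-1}),…,BRₙ^ε(p_{-n}))`. -/
def BR (Y : ι → Finset A) (u : (ι → A) → ℝ) (ε : ℝ) (p : ι → A → ℝ) :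
    Set (ι → A → ℝ) :=
  {b | ∀ i, b i ∈ BRi Y u ε p i}

/-- The profile obtained from `y` by swapping the strategies of players `i` and `j`. -/
def swapStrat (y : ι → A) (i j : ι) : ι → A :=
  Function.update (Function.update y i (y j)) j (y i)

/-- `cls : ι → κ` encodes a permutation-invariant partition of the player set (the classes
are the fibers of `cls`): players in the same class have the same action set, and the utility
is invariant under swapping the strategies of two same-class players in any strategy profile. -/
def PermInvariant (Y : ι → Finset A) (u : (ι → A) → ℝ) (cls : ι → κ) : Prop :=
  ∀ i j : ι, cls i = cls j →
    Y i = Y j ∧ ∀ y : ι → A, (∀ k, y k ∈ Y k) → u (swapStrat y i j) = u y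

/-- The equivalence class (as a finset of players) of player `i`. -/
def cluster (cls : ι → κ) (i : ι) : Finset ι :=
  Finset.univ.filter (fun j => cls j = cls i)

/-- The centroid distribution `p̄`: player `i` is assigned the average of the strategies of
the players in `i`'s class. -/
def centroid (cls : ι → κ) (p : ι → A → ℝ) : ι → A → ℝ :=
  fun i => ((cluster cls i).card : ℝ)⁻¹ • ∑ j ∈ cluster cls i, p j

/-- A joint strategy is class-constant if same-class players use identical strategies. -/
def classConst (cls : ι → κ) (p : ι → A → ℝ) : Prop :=
  ∀ i j, cls i = cls j → p i = p j

/-- The set of Nash equilibria. -/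
def NE (Y : ι → Finset A) (u : (ι → A) → ℝ) : Set (ι → A → ℝ) :=
  {p | p ∈ Delta Y ∧ ∀ i, ∀ qi ∈ simplex (Y i),
    U u (Function.update p i qi) ≤ U u p}

/-- The set of symmetric Nash equilibria relative to the partition `cls`. -/
def SNE (Y : ι → Finset A) (u : (ι → A) → ℝ) (cls : ι → κ) : Set (ι → A → ℝ) :=
  {p | p ∈ NE Y u ∧ classConst cls p}

/-- The set of mean-centric equilibria relative to the partition `cls`:
`U(pᵢ, p̄_{-i}) ≥ U(pᵢ', p̄_{-i})` for all `pᵢ' ∈ Δᵢ` and all `i`. -/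
def MCE (Y : ι → Finset A) (u : (ι → A) → ℝ) (cls : ι → κ) : Set (ι → A → ℝ) :=
  {p | p ∈ Delta Y ∧ ∀ i, ∀ qi ∈ simplex (Y i),
    U u (Function.update (centroid cls p) i qi)
      ≤ U u (Function.update (centroid cls p) i (p i))}

/-- `V(p) = (1/n) ∑ᵢ U(pᵢ, p̄_{-i})`. -/
def Vfun (u : (ι → A) → ℝ) (cls : ι → κ) (p : ι → A → ℝ) : ℝ :=
  (Fintype.card ι : ℝ)⁻¹ * ∑ i, U u (Function.update (centroid cls p) i (p i))

/-- A discrete-time ECFP process w.r.t. `(Γ, 𝒞)`: `q(1) = a(1)`,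
`q(t+1) = q(t) + γₜ (a(t+1) − q(t))` and `a(t+1) ∈ BR^{εₜ}(q̄(t))` for all `t`
(time is indexed by `ℕ`, i.e. `t = 0` plays the role of `t = 1` in the paper). -/
structure IsECFP (Y : ι → Finset A) (u : (ι → A) → ℝ) (cls : ι → κ)
    (γ ε : ℕ → ℝ) (a q : ℕ → ι → A → ℝ) : Prop where
  a_init_mem : a 0 ∈ Delta Y
  q_mem : ∀ t, q t ∈ Delta Y
  init : q 0 = a 0
  step : ∀ t, q (t + 1) = q t + γ t • (a (t + 1) - q t)
  br : ∀ t, a (t + 1) ∈ BR Y u (ε t) (centroid cls (q t))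

/-- A solution of the differential inclusion `ẋ ∈ F(x)` taking values in `Δⁿ`:
an everywhere-`Δⁿ`-valued trajectory on `[0,∞)` which is the integral of a locally
integrable selection `g(t) ∈ F(x(t))` (a.e.). -/
def IsSolution (Y : ι → Finset A) (F : (ι → A → ℝ) → Set (ι → A → ℝ))
    (x : ℝ → ι → A → ℝ) : Prop :=
  (∀ t : ℝ, 0 ≤ t → x t ∈ Delta Y) ∧
  ∃ g : ℝ → ι → A → ℝ,
    LocallyIntegrableOn g (Set.Ici (0 : ℝ)) ∧
    (∀ᵐ t ∂(volume.restrict (Set.Ici (0 : ℝ))), g t ∈ F (x t)) ∧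
    ∀ t : ℝ, 0 ≤ t → x t = x 0 + ∫ s in Set.Ioc (0 : ℝ) t, g s

/-- Right-hand side of the joint CT-ECFP differential inclusion `q̇ ∈ BR(q̄) − q`. -/
def Fjoint (Y : ι → Finset A) (u : (ι → A) → ℝ) (cls : ι → κ)
    (q : ι → A → ℝ) : Set (ι → A → ℝ) :=
  (fun b => b - q) '' BR Y u 0 (centroid cls q)

/-- Right-hand side of the centroid CT-ECFP differential inclusion `ẏ ∈ BR(y) − y`. -/
def Fcent (Y : ι → Finset A) (u : (ι → A) → ℝ)
    (y : ι → A → ℝ) : Set (ι → A → ℝ) :=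
  (fun b => b - y) '' BR Y u 0 y

/-- The ω-limit set of a continuous-time trajectory: all limits of sequences
`x(t_k)` with `t_k → ∞`. -/
def omegaLimitSet (x : ℝ → ι → A → ℝ) : Set (ι → A → ℝ) :=
  {p | ∃ tk : ℕ → ℝ, Tendsto tk atTop atTop ∧ Tendsto (fun k => x (tk k)) atTop (𝓝 p)}

/-- The set of limit points of a (discrete-time) sequence. -/
def seqLimitPoints (q : ℕ → ι → A → ℝ) : Set (ι → A → ℝ) :=
  {p | ∃ φ : ℕ → ℕ, StrictMono φ ∧ Tendsto (fun k => q (φ k)) atTop (𝓝 p)}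

/-- A compact set `X ⊆ Δⁿ` is internally chain transitive for the inclusion `ẋ ∈ F(x)`:
any two points of `X` can be joined, for every `ε > 0` and `T > 0`, by finitely many
solution pieces of duration `> T` staying in `X`, with jumps of size `≤ ε`. -/
def InternallyChainTransitive (Y : ι → Finset A)
    (F : (ι → A → ℝ) → Set (ι → A → ℝ)) (X : Set (ι → A → ℝ)) : Prop :=
  IsCompact X ∧ X ⊆ Delta Y ∧
  ∀ ξ ∈ X, ∀ η ∈ X, ∀ ε : ℝ, 0 < ε → ∀ T : ℝ, 0 < T →
    ∃ k : ℕ, 0 < k ∧ ∃ x : ℕ → ℝ → ι → A → ℝ, ∃ tt : ℕ → ℝ,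
      (∀ i < k, IsSolution Y F (x i)) ∧
      (∀ i < k, T < tt i) ∧
      (∀ i < k, ∀ s : ℝ, 0 ≤ s → s ≤ tt i → x i s ∈ X) ∧
      (∀ i, i + 1 < k → ‖x i (tt i) - x (i + 1) 0‖ ≤ ε) ∧
      ‖x 0 0 - ξ‖ ≤ ε ∧ ‖x (k - 1) (tt (k - 1)) - η‖ ≤ ε

section Dynamics

variable {E : Type*} [NormedAddCommGroup E]

/-- The limit set of a continuous, eventually precompact curve is preconnected. -/
theorem isPreconnected_setOf_mapClusterPt {w : ℝ → E} {K : Set E} (hK : IsCompact K)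
    (hwc : Continuous w) (hwK : ∀ᶠ t in atTop, w t ∈ K) :
    IsPreconnected {p | MapClusterPt p atTop w} := by
  have hcl : IsClosed {p | MapClusterPt p atTop w} := isClosed_setOfPred_clusterPt
  rw [isPreconnected_iff_subset_of_fully_disjoint_closed hcl]
  intro A B hA hB hAB hdisj
  obtain ⟨O, O', hO, hO', hAO, hBO', hOO'⟩ := normal_separation hA hB hdisj
  have hev : ∀ᶠ t in atTop, w t ∈ O ∪ O' := by
    by_contra hcon
    have hfr : ∃ᶠ t in atTop, w t ∈ K \ (O ∪ O') := by
      refine ((not_eventually.mp hcon).and_eventually hwK).mono ?_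
      rintro t ⟨h1, h2⟩
      exact ⟨h2, h1⟩
    obtain ⟨p, hp, hpc⟩ :=
      (hK.diff (hO.union hO')).exists_mapClusterPt_of_frequently hfr
    exact hp.2 ((hAB hpc).imp (fun h => hAO h) (fun h => hBO' h))
  obtain ⟨t₀, ht₀⟩ := eventually_atTop.mp hev
  have himage : IsPreconnected (w '' Set.Ici t₀) :=
    isPreconnected_Ici.image w hwc.continuousOn
  have hsub : w '' Set.Ici t₀ ⊆ O ∪ O' := by
    rintro _ ⟨t, ht, rfl⟩
    exact ht₀ t ht
  have key : ∀ {P Q : Set E} {p : E}, Disjoint P Q → IsOpen Q → w '' Set.Ici t₀ ⊆ P →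
      MapClusterPt p atTop w → p ∉ Q := by
    intro P Q p hPQ hQ hP hp hpQ
    obtain ⟨t, hQt, ht⟩ :=
      ((hp.frequently (hQ.mem_nhds hpQ)).and_eventually (eventually_ge_atTop t₀)).exists
    exact Set.disjoint_left.mp hPQ (hP ⟨t, ht, rfl⟩) hQt
  rcases IsPreconnected.subset_or_subset hO hO' hOO' hsub himage with h | h
  · refine Or.inl fun p hp => (hAB hp).resolve_right fun hpB => ?_
    exact key hOO' hO' h hp (hBO' hpB)
  · refine Or.inr fun p hp => (hAB hp).resolve_left fun hpA => ?_
    exact key hOO'.symm hO h hp (hAO hpA)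

/-- Pointwise limits of translates of a 1-Lipschitz function are 1-Lipschitz. -/
theorem lipschitzWith_of_tendsto_translates {w : ℝ → E} {𝓤 : Filter ℝ} [𝓤.NeBot]
    (hw : LipschitzWith 1 w) {x : ℝ → E} (hx : ∀ s, Tendsto (fun t => w (t + s)) 𝓤 (𝓝 (x s))) :
    LipschitzWith 1 x := by
  refine LipschitzWith.of_dist_le_mul fun s s' => ?_
  refine le_of_tendsto ((hx s).dist (hx s')) (Eventually.of_forall fun t => ?_)
  simpa using hw.dist_le_mul (t + s) (t + s')

variable [NormedSpace ℝ E]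

/-- `w` is the integral of a bounded `v` which asymptotically satisfies the inclusion whose
perturbed graph is `G`: the triple (perturbation size, base point, velocity) lies in `G`,
the perturbation size tends to `0` and the base point `z` is asymptotic to `w`. -/
structure IsPerturbedSolution (G : Set (ℝ × E × E)) (w v z : ℝ → E) (e : ℝ → ℝ) : Prop where
  stronglyMeasurable : StronglyMeasurable v
  norm_le : ∀ s, ‖v s‖ ≤ 1
  sub_eq_integral : ∀ s t, w t - w s = ∫ r in s..t, v r
  tendsto_perturbation : Tendsto e atTop (𝓝 0)
  tendsto_sub : Tendsto (fun s => z s - w s) atTop (𝓝 0)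
  mem : ∀ s, (e s, z s, v s) ∈ G

variable {G : Set (ℝ × E × E)} {w v z : ℝ → E} {e : ℝ → ℝ}

theorem IsPerturbedSolution.lipschitzWith (h : IsPerturbedSolution G w v z e) :
    LipschitzWith 1 w := by
  refine LipschitzWith.of_dist_le_mul fun t s => ?_
  rw [dist_eq_norm, h.sub_eq_integral, Real.dist_eq, NNReal.coe_one]
  exact intervalIntegral.norm_integral_le_of_norm_le_const fun r _ => h.norm_le r

theorem IsPerturbedSolution.intervalIntegrable (h : IsPerturbedSolution G w v z e) (a b : ℝ) :
    IntervalIntegrable v volume a b :=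
  (intervalIntegrable_const (c := (1 : ℝ))).mono_fun h.stronglyMeasurable.aestronglyMeasurable
    (Eventually.of_forall fun s => by simpa using h.norm_le s)

variable [FiniteDimensional ℝ E]

/-- A uniformly bounded set-valued map with closed graph is upper semicontinuous. -/
theorem eventually_mem_cthickening (hG : IsClosed G) (p : ℝ × E) {δ : ℝ} (hδ : 0 < δ) :
    ∀ᶠ q in 𝓝 p, ∀ d : E, ‖d‖ ≤ 1 → (q.1, q.2, d) ∈ G →
      d ∈ Metric.cthickening δ {d | (p.1, p.2, d) ∈ G} := by
  have : ProperSpace E := FiniteDimensional.proper ℝ E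
  set C : Set E := {d | (p.1, p.2, d) ∈ G}
  have hK : IsCompact (Metric.closedBall (0 : E) 1 \ Metric.thickening δ C) :=
    (isCompact_closedBall _ _).diff Metric.isOpen_thickening
  have hev := hK.eventually_forall_of_forall_eventually (x₀ := p)
    (P := fun q d => (q.1, q.2, d) ∉ G) (by
      intro d hd
      have hd' : (p.1, p.2, d) ∉ G := fun hdG =>
        hd.2 (Metric.self_subset_thickening hδ C hdG)
      have hcont : Continuous fun q : (ℝ × E) × E => (q.1.1, q.1.2, q.2) := by fun_prop
      exact (hcont.tendsto (p, d)).eventually (hG.isOpen_compl.mem_nhds hd'))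
  filter_upwards [hev] with q hq d hd hdG
  by_contra hcon
  exact hq d ⟨by simpa using hd, fun h => hcon (Metric.thickening_subset_cthickening δ C h)⟩ hdG

/-- Derivatives of limits of translates of a perturbed solution satisfy the limit inclusion. -/
theorem IsPerturbedSolution.mem_of_hasDerivAt (h : IsPerturbedSolution G w v z e)
    (hG : IsClosed G) (hconv : ∀ p, Convex ℝ {d | ((0 : ℝ), p, d) ∈ G})
    {𝓤 : Filter ℝ} [𝓤.NeBot] (h𝓤 : 𝓤 ≤ atTop) {x : ℝ → E}
    (hx : ∀ s, Tendsto (fun t => w (t + s)) 𝓤 (𝓝 (x s))) {s : ℝ} {d : E}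
    (hd : HasDerivAt x d s) : (0, x s, d) ∈ G := by
  set C : Set E := {d | ((0 : ℝ), x s, d) ∈ G}
  have hC : IsClosed C := hG.preimage (by fun_prop : Continuous fun d : E => ((0 : ℝ), x s, d))
  suffices hmem : ∀ δ > 0, d ∈ Metric.cthickening δ C by
    have : d ∈ closure C := by
      rw [Metric.closure_eq_iInter_cthickening]
      simpa using hmem
    rwa [hC.closure_eq] at this
  intro δ hδ
  have husc := eventually_mem_cthickening hG ((0 : ℝ), x s) hδ
  obtain ⟨r, hr, hball⟩ := Metric.eventually_nhds_iff.mp husc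
  have hslope : ∀ᶠ k in 𝓝[>] (0 : ℝ), k⁻¹ • (x (s + k) - x s) ∈ Metric.cthickening δ C := by
    have hsmall : ∀ᶠ k in 𝓝[>] (0 : ℝ), k ∈ Set.Ioo 0 (r / 3) :=
      Ioo_mem_nhdsGT (by positivity)
    filter_upwards [hsmall] with k hk
    have hlim : Tendsto (fun t => k⁻¹ • (w (t + (s + k)) - w (t + s))) 𝓤
        (𝓝 (k⁻¹ • (x (s + k) - x s))) := ((hx (s + k)).sub (hx s)).const_smul _
    refine Metric.isClosed_cthickening.mem_of_tendsto hlim ?_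
    have hbase : ∀ᶠ t in atTop, |e t| < r ∧ ‖z t - w t‖ < r / 3 := by
      refine Eventually.and ?_ ?_
      · simpa using h.tendsto_perturbation.eventually (Metric.ball_mem_nhds 0 hr)
      · simpa using h.tendsto_sub.eventually
          (Metric.ball_mem_nhds 0 (by positivity : 0 < r / 3))
    obtain ⟨t₀, ht₀⟩ := eventually_atTop.mp hbase
    have hnear : ∀ᶠ t in 𝓤, dist (w (t + s)) (x s) < r / 3 :=
      (hx s).eventually (Metric.ball_mem_nhds _ (by positivity : 0 < r / 3))
    filter_upwards [hnear, h𝓤 (eventually_ge_atTop (t₀ - s))] with t ht htt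
    have hvmem : ∀ t' ∈ Set.Ioc (t + s) (t + (s + k)), v t' ∈ Metric.cthickening δ C := by
      intro t' ht'
      obtain ⟨he, hz⟩ := ht₀ t' (by linarith [ht'.1])
      have hww : dist (w t') (w (t + s)) < r / 3 := by
        refine (h.lipschitzWith.dist_le_mul t' (t + s)).trans_lt ?_
        rw [NNReal.coe_one, one_mul, Real.dist_eq, abs_of_pos (by linarith [ht'.1])]
        linarith [ht'.2, hk.2]
      have hzx : dist (z t') (x s) < r := by
        have h1 := dist_triangle4 (z t') (w t') (w (t + s)) (x s)
        rw [dist_eq_norm (z t') (w t')] at h1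
        linarith
      refine hball (y := (e t', z t')) ?_ (v t') (h.norm_le t') (h.mem t')
      simpa [Prod.dist_eq] using ⟨he, hzx⟩
    have hle : t + s ≤ t + (s + k) := by linarith [hk.1]
    have hvol : volume (Set.Ioc (t + s) (t + (s + k))) = ENNReal.ofReal k := by
      rw [Real.volume_Ioc]; congr 1; ring
    have havg := ((hconv (x s)).cthickening δ).set_average_mem Metric.isClosed_cthickening
      (μ := volume) (t := Set.Ioc (t + s) (t + (s + k))) (f := v)
      (by rw [hvol]; simpa using hk.1) (by rw [hvol]; exact ENNReal.ofReal_ne_top)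
      ((ae_restrict_iff' measurableSet_Ioc).mpr (Eventually.of_forall hvmem))
      ((intervalIntegrable_iff_integrableOn_Ioc_of_le hle).mp (h.intervalIntegrable _ _))
    rwa [setAverage_eq, measureReal_def, hvol, ENNReal.toReal_ofReal hk.1.le,
      ← intervalIntegral.integral_of_le hle, ← h.sub_eq_integral] at havg
  exact Metric.isClosed_cthickening.mem_of_tendsto hd.tendsto_slope_zero_right hslope

/-- The fundamental theorem of calculus for Lipschitz curves. -/
theorem integral_deriv_eq_sub_of_lipschitzWith {c : NNReal} {x : ℝ → E} (hx : LipschitzWith c x)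
    (a b : ℝ) : ∫ s in a..b, deriv x s = x b - x a := by
  have hloc : LocallyIntegrable (deriv x) volume :=
    (locallyIntegrable_const (c : ℝ)).mono (aestronglyMeasurable_deriv x _)
      (Eventually.of_forall fun s => by simpa using norm_deriv_le_of_lipschitz hx)
  have hint : ∀ s t, IntervalIntegrable (deriv x) volume s t :=
    fun s t => (hloc.integrableOn_isCompact isCompact_uIcc).intervalIntegrable
  have hI : LipschitzWith c fun t => ∫ s in a..t, deriv x s := by
    refine LipschitzWith.of_dist_le_mul fun t s => ?_
    rw [dist_eq_norm, intervalIntegral.integral_interval_sub_left (hint _ _) (hint _ _),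
      Real.dist_eq]
    exact intervalIntegral.norm_integral_le_of_norm_le_const
      fun r _ => norm_deriv_le_of_lipschitz hx
  have hae : ∀ᵐ t : ℝ, t ∈ Set.uIcc a b →
      HasDerivAt (fun t => x t - ∫ s in a..t, deriv x s) 0 t := by
    filter_upwards [hx.ae_differentiableAt_real, LocallyIntegrable.ae_hasDerivAt_integral hloc] with t h1 h2 _
    have h3 := h1.hasDerivAt.sub (h2 a)
    rwa [sub_self] at h3
  obtain ⟨p, hp⟩ := AbsolutelyContinuousOnInterval.const_of_ae_hasDerivAt_zero
    ((hx.sub hI).lipschitzOnWith.absolutelyContinuousOnInterval) hae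
  have ha := hp a Set.left_mem_uIcc
  have hb := hp b Set.right_mem_uIcc
  simp only [intervalIntegral.integral_same, sub_zero] at ha
  rw [ha, ← hb, sub_sub_cancel]

/-- `x` is a Lipschitz solution of the limit inclusion that stays in the limit set of `w`. -/
structure IsLimitTrajectory (G : Set (ℝ × E × E)) (w x : ℝ → E) : Prop where
  lipschitzWith : LipschitzWith 1 x
  mapClusterPt : ∀ s, MapClusterPt (x s) atTop w
  ae_mem : ∀ᵐ s, ((0 : ℝ), x s, deriv x s) ∈ G

theorem IsPerturbedSolution.exists_isLimitTrajectory (h : IsPerturbedSolution G w v z e)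
    (hG : IsClosed G) (hconv : ∀ p, Convex ℝ {d | ((0 : ℝ), p, d) ∈ G})
    {K : Set E} (hK : IsCompact K) (hwK : ∀ᶠ t in atTop, w t ∈ K) {𝓤 : Ultrafilter ℝ}
    (h𝓤 : (𝓤 : Filter ℝ) ≤ atTop) :
    ∃ x, IsLimitTrajectory G w x ∧ ∀ s, Tendsto (fun t => w (t + s)) 𝓤 (𝓝 (x s)) := by
  have htr : ∀ s, Tendsto (fun t : ℝ => t + s) 𝓤 atTop :=
    fun s => (tendsto_atTop_add_const_right _ s tendsto_id).mono_left h𝓤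
  have hlim : ∀ s, ∃ p, Tendsto (fun t => w (t + s)) 𝓤 (𝓝 p) := fun s => by
    obtain ⟨p, -, hp⟩ := hK.ultrafilter_le_nhds (𝓤.map fun t => w (t + s))
      (le_principal_iff.mpr ((htr s).eventually hwK))
    exact ⟨p, hp⟩
  choose x hx using hlim
  have hxlip := lipschitzWith_of_tendsto_translates h.lipschitzWith hx
  refine ⟨x, ⟨hxlip, fun s => (hx s).mapClusterPt.of_comp (htr s), ?_⟩, hx⟩
  filter_upwards [hxlip.ae_differentiableAt_real] with s hs
  exact h.mem_of_hasDerivAt hG hconv h𝓤 hx hs.hasDerivAt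

/-- Far out in time, a perturbed solution is shadowed on bounded time intervals by solutions of
the limit inclusion which stay in its limit set. -/
theorem IsPerturbedSolution.eventually_exists_shadow (h : IsPerturbedSolution G w v z e)
    (hG : IsClosed G) (hconv : ∀ p, Convex ℝ {d | ((0 : ℝ), p, d) ∈ G})
    {K : Set E} (hK : IsCompact K) (hwK : ∀ᶠ t in atTop, w t ∈ K) (S : ℝ) {δ : ℝ}
    (hδ : 0 < δ) :
    ∀ᶠ t in atTop, ∀ ℓ ∈ Set.Icc 0 S, ∃ x : ℝ → E, IsLimitTrajectory G w x ∧
      dist (x 0) (w t) ≤ δ ∧ dist (x ℓ) (w (t + ℓ)) ≤ δ := by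
  by_contra hcon
  obtain ⟨𝓤, h𝓤⟩ := Filter.exists_ultrafilter_iff.mpr
    (frequently_mem_iff_neBot.mp (not_eventually.mp hcon))
  have hbad := h𝓤.trans inf_le_right (mem_principal_self _)
  have hbad' : ∀ᶠ t in (𝓤 : Filter ℝ), ∃ ℓ, ℓ ∈ Set.Icc 0 S ∧ ∀ x : ℝ → E,
      IsLimitTrajectory G w x → dist (x 0) (w t) ≤ δ → δ < dist (x ℓ) (w (t + ℓ)) := by
    filter_upwards [hbad] with t ht
    replace ht : ¬_ := ht
    push Not at ht
    exact ht
  obtain ⟨f, hf⟩ := hbad'.choice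
  obtain ⟨x, hxt, hx⟩ := h.exists_isLimitTrajectory hG hconv hK hwK (h𝓤.trans inf_le_left)
  obtain ⟨ℓ₀, -, hℓ₀⟩ := isCompact_Icc.ultrafilter_le_nhds (𝓤.map f)
    (le_principal_iff.mpr (hf.mono fun t ht => ht.1))
  have h0 : ∀ᶠ t in (𝓤 : Filter ℝ), dist (w (t + 0)) (x 0) < δ :=
    (hx 0).eventually (Metric.ball_mem_nhds _ hδ)
  have h1 : ∀ᶠ t in (𝓤 : Filter ℝ), dist (w (t + ℓ₀)) (x ℓ₀) < δ / 3 :=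
    (hx ℓ₀).eventually (Metric.ball_mem_nhds _ (by positivity))
  have h2 : ∀ᶠ t in (𝓤 : Filter ℝ), dist (f t) ℓ₀ < δ / 3 :=
    hℓ₀ (Metric.ball_mem_nhds _ (by positivity))
  obtain ⟨t, ⟨⟨⟨-, ht⟩, ht0⟩, ht1⟩, ht2⟩ := (((hf.and h0).and h1).and h2).exists
  rw [add_zero, dist_comm] at ht0
  have h3 := ht x hxt ht0.le
  have h4 := hxt.lipschitzWith.dist_le_mul (f t) ℓ₀
  have h5 := h.lipschitzWith.dist_le_mul (t + ℓ₀) (t + f t)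
  have h6 := dist_triangle4 (x (f t)) (x ℓ₀) (w (t + ℓ₀)) (w (t + f t))
  rw [dist_comm] at ht1
  simp only [dist_add_left, NNReal.coe_one, one_mul] at h4 h5
  rw [dist_comm ℓ₀] at h5
  linarith

/-- Any two limit points of a perturbed solution are joined by a chain of solutions of the limit
inclusion which stay in its limit set. -/
theorem IsPerturbedSolution.exists_chain (h : IsPerturbedSolution G w v z e)
    (hG : IsClosed G) (hconv : ∀ p, Convex ℝ {d | ((0 : ℝ), p, d) ∈ G})
    {K : Set E} (hK : IsCompact K) (hwK : ∀ᶠ t in atTop, w t ∈ K) {ξ η : E}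
    (hξ : MapClusterPt ξ atTop w) (hη : MapClusterPt η atTop w) {δ T : ℝ} (hδ : 0 < δ)
    (hT : 0 < T) :
    ∃ k : ℕ, 0 < k ∧ ∃ (x : ℕ → ℝ → E) (ℓ : ℝ), T < ℓ ∧
      (∀ i, IsLimitTrajectory G w (x i)) ∧
      (∀ i, ‖x i ℓ - x (i + 1) 0‖ ≤ δ) ∧
      ‖x 0 0 - ξ‖ ≤ δ ∧ ‖x (k - 1) ℓ - η‖ ≤ δ := by
  have hshadow := h.eventually_exists_shadow hG hconv hK hwK (2 * (T + 1)) (half_pos hδ)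
  obtain ⟨t₀, ht₀⟩ := eventually_atTop.mp hshadow
  obtain ⟨ta, hta, hta₀⟩ := ((hξ.frequently (Metric.ball_mem_nhds ξ (half_pos hδ))).and_eventually
    (eventually_ge_atTop t₀)).exists
  obtain ⟨tb, htb, htab⟩ := ((hη.frequently (Metric.ball_mem_nhds η (half_pos hδ))).and_eventually
    (eventually_ge_atTop (ta + (T + 1)))).exists
  set k := ⌊(tb - ta) / (T + 1)⌋₊
  have hT1 : 0 < T + 1 := by linarith
  have hq1 : 1 ≤ (tb - ta) / (T + 1) := by rw [le_div_iff₀ hT1]; linarith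
  have hkpos : 0 < k := Nat.floor_pos.mpr hq1
  have hk1 : (1 : ℝ) ≤ k := by exact_mod_cast hkpos
  have hkle : (k : ℝ) * (T + 1) ≤ tb - ta := by
    rw [← le_div_iff₀ hT1]; exact Nat.floor_le (by linarith)
  have hklt : tb - ta < (k + 1) * (T + 1) := by
    rw [← div_lt_iff₀ hT1]; exact Nat.lt_floor_add_one _
  set ℓ := (tb - ta) / k with hℓ
  have hk0 : (0 : ℝ) < k := by linarith
  have hℓk : k * ℓ = tb - ta := by rw [hℓ]; field_simp
  have hℓ1 : T + 1 ≤ ℓ := by rw [hℓ, le_div_iff₀ hk0]; linarith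
  have hℓ2 : ℓ ≤ 2 * (T + 1) := by rw [hℓ, div_le_iff₀ hk0]; nlinarith
  have hstep : ∀ i : ℕ, t₀ ≤ ta + i * ℓ := fun i => by
    have : 0 ≤ i * ℓ := mul_nonneg i.cast_nonneg (by linarith)
    linarith
  choose x hx hx0 hxℓ using
    fun i : ℕ => ht₀ (ta + i * ℓ) (hstep i) ℓ ⟨by linarith, hℓ2⟩
  refine ⟨k, hkpos, x, ℓ, by linarith, hx, fun i => ?_, ?_, ?_⟩
  · have h1 := hxℓ i
    have h2 := hx0 (i + 1)
    rw [show ta + ((i + 1 : ℕ) : ℝ) * ℓ = ta + i * ℓ + ℓ by push_cast; ring] at h2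
    rw [← dist_eq_norm]
    linarith [dist_triangle_right (x i ℓ) (x (i + 1) 0) (w (ta + i * ℓ + ℓ))]
  · have h1 := hx0 0
    simp only [Nat.cast_zero, zero_mul, add_zero] at h1
    rw [← dist_eq_norm]
    linarith [dist_triangle (x 0 0) (w ta) ξ]
  · have h1 := hxℓ (k - 1)
    rw [show ta + ((k - 1 : ℕ) : ℝ) * ℓ + ℓ = tb by
      rw [Nat.cast_sub hkpos, Nat.cast_one]; linarith] at h1
    rw [← dist_eq_norm]
    linarith [dist_triangle (x (k - 1) ℓ) (w tb) η]

/-- The piecewise affine interpolation of a discrete recursion with vanishing steps is a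
perturbed solution of the limit inclusion. -/
theorem exists_interpolation {γ : ℕ → ℝ} (hγ : ∀ n, 0 ≤ γ n)
    (hγdiv : Tendsto (fun n => ∑ t ∈ Finset.range n, γ t) atTop atTop)
    (hγ0 : Tendsto γ atTop (𝓝 0)) {y d : ℕ → E} (hy : ∀ n, y (n + 1) = y n + γ n • d n)
    (hd : ∀ n, ‖d n‖ ≤ 1) {e : ℕ → ℝ} (he : Tendsto e atTop (𝓝 0))
    (hG : ∀ n, (e n, y n, d n) ∈ G) :
    ∃ (N : ℝ → ℕ) (w : ℝ → E), Tendsto N atTop atTop ∧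
      (∀ n, w (∑ t ∈ Finset.range n, γ t) = y n) ∧
      IsPerturbedSolution G w (d ∘ N) (y ∘ N) (e ∘ N) := by
  set τ : ℕ → ℝ := fun n => ∑ t ∈ Finset.range n, γ t
  have hτsucc : ∀ n, τ (n + 1) = τ n + γ n := fun n => Finset.sum_range_succ _ _
  have hτ0 : τ 0 = 0 := Finset.sum_range_zero _
  have hτmono : Monotone τ := monotone_nat_of_le_succ fun n => by linarith [hτsucc n, hγ n]
  have hex : ∀ s, ∃ m, s < τ (m + 1) := fun s =>
    ((hγdiv.comp (tendsto_add_atTop_nat 1)).eventually_gt_atTop s).exists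
  set N : ℝ → ℕ := fun s => Nat.find (hex s)
  have hNlt : ∀ s, s < τ (N s + 1) := fun s => Nat.find_spec (hex s)
  have hNle : ∀ s, 0 ≤ s → τ (N s) ≤ s := fun s hs => by
    rcases Nat.eq_zero_or_pos (N s) with h0 | hpos
    · rw [h0, hτ0]; exact hs
    · have : ¬s < τ (N s - 1 + 1) := Nat.find_min (hex s) (Nat.sub_lt hpos one_pos)
      rwa [Nat.sub_add_cancel hpos, not_lt] at this
  have hNmono : Monotone N := fun s s' hss =>
    Nat.find_min' (hex s) (hss.trans_lt (hNlt s'))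
  have hNeq : ∀ {s n}, τ n ≤ s → s < τ (n + 1) → N s = n := fun {s n} h1 h2 => by
    refine le_antisymm (Nat.find_min' (hex s) h2) (not_lt.mp fun hlt => ?_)
    exact absurd (hNlt s) (not_lt.mpr ((hτmono hlt).trans h1))
  have hNtop : Tendsto N atTop atTop := by
    refine tendsto_atTop_atTop.mpr fun b => ⟨τ b, fun s hs => not_lt.mp fun hlt => ?_⟩
    exact absurd (hNlt s) (not_lt.mpr ((hτmono hlt).trans hs))
  have hmeas : StronglyMeasurable (d ∘ N) :=
    StronglyMeasurable.of_discrete.comp_measurable hNmono.measurable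
  have hint : ∀ a b, IntervalIntegrable (d ∘ N) volume a b := fun a b =>
    (intervalIntegrable_const (c := (1 : ℝ))).mono_fun hmeas.aestronglyMeasurable
      (Eventually.of_forall fun s => by simpa using hd (N s))
  set w : ℝ → E := fun t => y 0 + ∫ s in (0 : ℝ)..t, d (N s) with hw
  have hsub : ∀ s t, w t - w s = ∫ r in s..t, d (N r) := fun s t => by
    simp only [hw, add_sub_add_left_eq_sub]
    exact intervalIntegral.integral_interval_sub_left (hint _ _) (hint _ _)
  have hpiece : ∀ n t, τ n ≤ t → t ≤ τ (n + 1) → w t - w (τ n) = (t - τ n) • d n := by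
    intro n t h1 h2
    rw [hsub, ← intervalIntegral.integral_const]
    refine intervalIntegral.integral_congr_ae' ?_ ?_
    · filter_upwards [Measure.ae_ne volume (τ (n + 1))] with s hs hs'
      rw [hNeq hs'.1.le (lt_of_le_of_ne (hs'.2.trans h2) hs)]
    · exact Eventually.of_forall fun s hs => absurd (hs.1.trans_le hs.2) (not_lt.mpr h1)
  have hwτ : ∀ n, w (τ n) = y n := by
    intro n
    induction n with
    | zero => simp [hw, hτ0]
    | succ n ih =>
      have := hpiece n _ (hτmono n.le_succ) le_rfl
      rw [ih, hτsucc, add_sub_cancel_left, sub_eq_iff_eq_add'] at this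
      rw [hτsucc, this, hy]
  refine ⟨N, w, hNtop, hwτ, hmeas, fun s => hd _, hsub, he.comp hNtop, ?_, fun s => hG _⟩
  refine squeeze_zero_norm' ?_ (hγ0.comp hNtop)
  filter_upwards [eventually_ge_atTop 0] with t ht
  have h1 := hNle t ht
  have h2 := hNlt t
  rw [Function.comp_apply, ← hwτ, norm_sub_rev, hpiece _ t h1 h2.le, norm_smul,
    Real.norm_of_nonneg (by linarith)]
  rw [hτsucc] at h2
  calc (t - τ (N t)) * ‖d (N t)‖ ≤ γ (N t) * 1 := by
        gcongr
        · exact hγ _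
        · linarith
        · exact hd _
    _ = (γ ∘ N) t := mul_one _

end Dynamics

section Game

set_option linter.unusedSectionVars false

theorem prod_update_apply (p : ι → A → ℝ) (i : ι) (r : A → ℝ) (y : ι → A) :
    ∏ j, Function.update p i r j (y j) = r (y i) * ∏ j ∈ Finset.univ.erase i, p j (y j) := by
  rw [← Finset.mul_prod_erase _ _ (Finset.mem_univ i), Function.update_self]
  congr 1
  refine Finset.prod_congr rfl fun j hj => ?_
  rw [Function.update_of_ne (Finset.ne_of_mem_erase hj)]

theorem U_update_add_smul (u : (ι → A) → ℝ) (p : ι → A → ℝ) (i : ι) (r r' : A → ℝ) (s t : ℝ) :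
    U u (Function.update p i (s • r + t • r')) =
      s * U u (Function.update p i r) + t * U u (Function.update p i r') := by
  simp only [U, prod_update_apply, Finset.mul_sum, ← Finset.sum_add_distrib, Pi.add_apply,
    Pi.smul_apply, smul_eq_mul]
  exact Finset.sum_congr rfl fun y _ => by ring

theorem continuous_U (u : (ι → A) → ℝ) : Continuous (U u) := by
  unfold U
  fun_prop

theorem le_one_of_mem_simplex {Y : Finset A} {p : A → ℝ} (hp : p ∈ simplex Y) (a : A) :
    p a ≤ 1 := by
  by_cases ha : a ∈ Y
  · exact hp.2.2 ▸ Finset.single_le_sum (fun b _ => hp.1 b) ha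
  · rw [hp.2.1 a ha]; exact zero_le_one

theorem convex_simplex (Y : Finset A) : Convex ℝ (simplex Y) := by
  intro p hp r hr s t hs ht hst
  refine ⟨fun a => ?_, fun a ha => ?_, ?_⟩
  · have := hp.1 a
    have := hr.1 a
    simp only [Pi.add_apply, Pi.smul_apply, smul_eq_mul]
    positivity
  · simp [hp.2.1 a ha, hr.2.1 a ha]
  · simp [Finset.sum_add_distrib, ← Finset.mul_sum, hp.2.2, hr.2.2, hst]

theorem isClosed_simplex (Y : Finset A) : IsClosed (simplex Y) := by
  have h : simplex Y = (⋂ a, {p : A → ℝ | 0 ≤ p a}) ∩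
      ((⋂ a ∈ {a | a ∉ Y}, {p : A → ℝ | p a = 0}) ∩ {p | ∑ a ∈ Y, p a = 1}) := by
    ext p
    simp [simplex]
  rw [h]
  exact (isClosed_iInter fun a => isClosed_le (by fun_prop) (by fun_prop)).inter
    ((isClosed_biInter fun a _ => isClosed_eq (by fun_prop) (by fun_prop)).inter
      (isClosed_eq (by fun_prop) (by fun_prop)))

theorem isCompact_simplex (Y : Finset A) : IsCompact (simplex Y) :=
  (isCompact_univ_pi fun _ : A => isCompact_Icc (a := (0 : ℝ)) (b := 1)).of_isClosed_subset
    (isClosed_simplex Y) fun _ hp a _ => ⟨hp.1 a, le_one_of_mem_simplex hp a⟩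

theorem isCompact_Delta (Y : ι → Finset A) : IsCompact (Delta Y) := by
  convert isCompact_univ_pi fun i => isCompact_simplex (Y i)
  ext p
  simp [Delta]

theorem norm_sub_le_one_of_mem_Delta {Y : ι → Finset A} {p r : ι → A → ℝ} (hp : p ∈ Delta Y)
    (hr : r ∈ Delta Y) : ‖p - r‖ ≤ 1 := by
  refine (pi_norm_le_iff_of_nonneg zero_le_one).mpr fun i =>
    (pi_norm_le_iff_of_nonneg zero_le_one).mpr fun a => ?_
  rw [Pi.sub_apply, Pi.sub_apply, Real.norm_eq_abs, abs_le]
  constructor <;> linarith [(hp i).1 a, (hr i).1 a, le_one_of_mem_simplex (hp i) a,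
    le_one_of_mem_simplex (hr i) a]

theorem convex_BRi (Y : ι → Finset A) (u : (ι → A) → ℝ) (ε : ℝ) (p : ι → A → ℝ) (i : ι) :
    Convex ℝ (BRi Y u ε p i) := by
  intro r hr r' hr' s t hs ht hst
  refine ⟨convex_simplex _ hr.1 hr'.1 hs ht hst, fun x hx => ?_⟩
  rw [U_update_add_smul]
  have h1 := mul_le_mul_of_nonneg_left (hr.2 x hx) hs
  have h2 := mul_le_mul_of_nonneg_left (hr'.2 x hx) ht
  have h3 : s * (U u (Function.update p i x) - ε) + t * (U u (Function.update p i x) - ε) =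
      U u (Function.update p i x) - ε := by rw [← add_mul, hst, one_mul]
  linarith

theorem convex_BR (Y : ι → Finset A) (u : (ι → A) → ℝ) (ε : ℝ) (p : ι → A → ℝ) :
    Convex ℝ (BR Y u ε p) :=
  fun _ hb _ hb' _ _ hs ht hst i => convex_BRi Y u ε p i (hb i) (hb' i) hs ht hst

/-- The graph of the perturbed centroid inclusion, as triples (perturbation, point, velocity). -/
def perturbedGraph (Y : ι → Finset A) (u : (ι → A) → ℝ) :
    Set (ℝ × (ι → A → ℝ) × (ι → A → ℝ)) :=
  {q | q.2.1 + q.2.2 ∈ BR Y u q.1 q.2.1}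

theorem isClosed_perturbedGraph (Y : ι → Finset A) (u : (ι → A) → ℝ) :
    IsClosed (perturbedGraph Y u) := by
  have h : perturbedGraph Y u = ⋂ i, {q | (q.2.1 + q.2.2) i ∈ simplex (Y i)} ∩
      ⋂ x ∈ simplex (Y i), {q : ℝ × (ι → A → ℝ) × (ι → A → ℝ) |
        U u (Function.update q.2.1 i x) - q.1 ≤
          U u (Function.update q.2.1 i ((q.2.1 + q.2.2) i))} := by
    ext q
    simp [perturbedGraph, BR, BRi]
  rw [h]
  refine isClosed_iInter fun i => ((isClosed_simplex (Y i)).preimage (by fun_prop)).inter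
    (isClosed_biInter fun x _ => isClosed_le ?_ ?_)
  · exact ((continuous_U u).comp (by fun_prop)).sub continuous_fst
  · exact (continuous_U u).comp
      (continuous_snd.fst.update i (by fun_prop))

theorem convex_perturbedGraph_section (Y : ι → Finset A) (u : (ι → A) → ℝ) (p : ι → A → ℝ) :
    Convex ℝ {d | ((0 : ℝ), p, d) ∈ perturbedGraph Y u} :=
  (convex_BR Y u 0 p).translate_preimage_right p

theorem mem_Fcent_of_mem_perturbedGraph {Y : ι → Finset A} {u : (ι → A) → ℝ}
    {p d : ι → A → ℝ} (h : ((0 : ℝ), p, d) ∈ perturbedGraph Y u) : d ∈ Fcent Y u p :=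
  ⟨p + d, h, add_sub_cancel_left p d⟩

theorem centroid_apply_mem {cls : ι → κ} {p : ι → A → ℝ} {i : ι} {S : Set (A → ℝ)}
    (hS : Convex ℝ S) (hp : ∀ j, cls j = cls i → p j ∈ S) : centroid cls p i ∈ S := by
  have hcard : ((cluster cls i).card : ℝ) ≠ 0 := by
    rw [Nat.cast_ne_zero, Finset.card_ne_zero]
    exact ⟨i, by simp [cluster]⟩
  rw [centroid, Finset.smul_sum]
  refine hS.sum_mem (fun _ _ => by positivity) ?_ fun j hj => hp j (by simpa [cluster] using hj)
  rw [Finset.sum_const, nsmul_eq_mul, mul_inv_cancel₀ hcard]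

theorem centroid_add_smul_sub (cls : ι → κ) (p r : ι → A → ℝ) (c : ℝ) :
    centroid cls (p + c • (r - p)) = centroid cls p + c • (centroid cls r - centroid cls p) := by
  ext i x
  simp only [centroid, Pi.add_apply, Pi.smul_apply, Pi.sub_apply, Finset.sum_apply, smul_eq_mul,
    Finset.sum_add_distrib, ← Finset.mul_sum, Finset.sum_sub_distrib]
  ring

theorem classConst_centroid (cls : ι → κ) (p : ι → A → ℝ) : classConst cls (centroid cls p) := by
  intro i j h
  simp [centroid, cluster, h]

variable {Y : ι → Finset A} {u : (ι → A) → ℝ} {cls : ι → κ}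

theorem centroid_mem_Delta (hpi : PermInvariant Y u cls) {p : ι → A → ℝ} (hp : p ∈ Delta Y) :
    centroid cls p ∈ Delta Y :=
  fun i => centroid_apply_mem (convex_simplex _) fun j hj => (hpi j i hj).1 ▸ hp j

theorem swapStrat_eq_comp_swap (y : ι → A) (i j : ι) :
    swapStrat y i j = y ∘ Equiv.swap i j := by
  ext k
  simp only [swapStrat, Function.update_apply, Function.comp_apply, Equiv.swap_apply_def]
  split_ifs <;> simp_all

/-- Against a class-constant profile, players of the same class face the same payoffs. -/
theorem U_update_eq_of_cls_eq (hpi : PermInvariant Y u cls) {p : ι → A → ℝ} (hp : p ∈ Delta Y)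
    (hc : classConst cls p) {i j : ι} (hij : cls i = cls j) {r : A → ℝ}
    (hr : r ∈ simplex (Y i)) :
    U u (Function.update p j r) = U u (Function.update p i r) := by
  unfold U
  refine (Fintype.sum_equiv ((Equiv.swap i j).arrowCongr (Equiv.refl A)) _ _ fun y => ?_).symm
  have hprod : ∏ k, Function.update p j r k (y (Equiv.swap i j k)) =
      ∏ k, Function.update p i r k (y k) := by
    refine Fintype.prod_equiv (Equiv.swap i j) _ _ fun k => ?_
    simp only [Function.update_apply, Equiv.swap_apply_def]
    have := hc i j hij
    split_ifs <;> simp_all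
  have heq : (Equiv.swap i j).arrowCongr (Equiv.refl A) y = swapStrat y i j := by
    rw [swapStrat_eq_comp_swap]
    ext k
    simp
  rw [heq, swapStrat_eq_comp_swap]
  simp only [Function.comp_apply, hprod, ← swapStrat_eq_comp_swap]
  by_cases hy : ∀ k, y k ∈ Y k
  · rw [(hpi i j hij).2 y hy]
  · push Not at hy
    obtain ⟨k, hk⟩ := hy
    have hmem : Function.update p i r k ∈ simplex (Y k) := by
      rcases eq_or_ne k i with rfl | hki
      · simpa using hr
      · simpa [hki] using hp k
    rw [Finset.prod_eq_zero (Finset.mem_univ k) (hmem.2.1 _ hk), mul_zero, mul_zero]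

theorem BRi_subset_of_cls_eq (hpi : PermInvariant Y u cls) {p : ι → A → ℝ} (hp : p ∈ Delta Y)
    (hc : classConst cls p) {i j : ι} (hij : cls i = cls j) (ε : ℝ) :
    BRi Y u ε p j ⊆ BRi Y u ε p i := by
  rintro r ⟨hr, hbest⟩
  have hY := (hpi i j hij).1
  rw [← hY] at hr
  refine ⟨hr, fun x hx => ?_⟩
  rw [← U_update_eq_of_cls_eq hpi hp hc hij hr, ← U_update_eq_of_cls_eq hpi hp hc hij hx]
  exact hbest x (hY ▸ hx)

theorem centroid_mem_BR (hpi : PermInvariant Y u cls) {p b : ι → A → ℝ} (hp : p ∈ Delta Y)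
    (hc : classConst cls p) {ε : ℝ} (hb : b ∈ BR Y u ε p) : centroid cls b ∈ BR Y u ε p :=
  fun _ => centroid_apply_mem (convex_BRi _ _ _ _ _) fun j hj =>
    BRi_subset_of_cls_eq hpi hp hc hj.symm ε (hb j)

theorem seqLimitPoints_eq (y : ℕ → ι → A → ℝ) :
    seqLimitPoints y = {p | MapClusterPt p atTop y} := by
  ext p
  exact ⟨fun ⟨_, hφ, h⟩ => h.mapClusterPt.of_comp hφ.tendsto_atTop,
    MapClusterPt.tendsto_subseq⟩

/-- A limit trajectory of the perturbed centroid dynamics solves the centroid inclusion. -/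
theorem IsLimitTrajectory.isSolution {w x : ℝ → ι → A → ℝ}
    (hx : IsLimitTrajectory (perturbedGraph Y u) w x)
    (hL : ∀ p, MapClusterPt p atTop w → p ∈ Delta Y) : IsSolution Y (Fcent Y u) x := by
  refine ⟨fun t _ => hL _ (hx.mapClusterPt t), deriv x, ?_, ?_, fun t ht => ?_⟩
  · exact ((locallyIntegrable_const (1 : ℝ)).mono (aestronglyMeasurable_deriv x _)
      (Eventually.of_forall fun s => by
        simpa using norm_deriv_le_of_lipschitz hx.lipschitzWith)).locallyIntegrableOn _
  · exact ae_restrict_of_ae (hx.ae_mem.mono fun s hs => mem_Fcent_of_mem_perturbedGraph hs)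
  · rw [← intervalIntegral.integral_of_le ht,
      integral_deriv_eq_sub_of_lipschitzWith hx.lipschitzWith, add_sub_cancel]

end Game

variable [Nonempty ι]

/-- **Lemma 4(i).** The set of limit points of the centroid sequence `{q̄(t)}` of a
discrete-time ECFP process is a connected, internally chain transitive set of the centroid
differential inclusion `ẏ ∈ BR(y) − y`. -/
theorem centroid_limit_points_chain_transitive
    (Y : ι → Finset A) (hY : ∀ i, (Y i).Nonempty) (u : (ι → A) → ℝ)
    (cls : ι → κ) (hpi : PermInvariant Y u cls)
    (γ ε : ℕ → ℝ) (a q : ℕ → ι → A → ℝ)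
    (hproc : IsECFP Y u cls γ ε a q)
    (hγnonneg : ∀ t, 0 ≤ γ t)
    (hγdiv : Tendsto (fun n => ∑ t ∈ Finset.range n, γ t) atTop atTop)
    (hγ0 : Tendsto γ atTop (𝓝 0))
    (hεnonneg : ∀ t, 0 ≤ ε t)
    (hε0 : Tendsto ε atTop (𝓝 0)) :
    IsConnected (seqLimitPoints (fun t => centroid cls (q t))) ∧
      InternallyChainTransitive Y (Fcent Y u)
        (seqLimitPoints (fun t => centroid cls (q t))) := by
  set y : ℕ → ι → A → ℝ := fun t => centroid cls (q t) with hy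
  have hyΔ : ∀ n, y n ∈ Delta Y := fun n => centroid_mem_Delta hpi (hproc.q_mem n)
  have hbBR : ∀ n, centroid cls (a (n + 1)) ∈ BR Y u (ε n) (y n) := fun n =>
    centroid_mem_BR hpi (hyΔ n) (classConst_centroid cls (q n)) (hproc.br n)
  obtain ⟨N, w, hN, hwy, hw⟩ := exists_interpolation (G := perturbedGraph Y u) hγnonneg hγdiv hγ0
    (y := y) (d := fun n => centroid cls (a (n + 1)) - y n)
    (fun n => by simp only [hy, hproc.step, centroid_add_smul_sub])
    (fun n => norm_sub_le_one_of_mem_Delta (fun i => (hbBR n i).1) (hyΔ n)) hε0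
    (fun n => by simpa [perturbedGraph] using hbBR n)
  have hΔ := isCompact_Delta Y
  have hL : seqLimitPoints y = {p | MapClusterPt p atTop w} := by
    rw [seqLimitPoints_eq]
    ext p
    constructor
    · intro hp
      refine MapClusterPt.of_comp hγdiv ?_
      rwa [show w ∘ (fun n => ∑ t ∈ Finset.range n, γ t) = y from funext hwy]
    · intro hp
      obtain ⟨𝓤, h𝓤, hlim⟩ := mapClusterPt_iff_ultrafilter.mp hp
      have hyN : Tendsto (y ∘ N) 𝓤 (𝓝 p) := by
        simpa [Function.comp_def] using (hw.tendsto_sub.mono_left h𝓤).add hlim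
      exact (hyN.mapClusterPt).of_comp (hN.mono_left h𝓤)
  have hLΔ : seqLimitPoints y ⊆ Delta Y := fun p ⟨_, _, h⟩ =>
    hΔ.isClosed.mem_of_tendsto h (Eventually.of_forall fun _ => hyΔ _)
  have hLΔ' : ∀ p, MapClusterPt p atTop w → p ∈ Delta Y := fun p hp => hLΔ (hL ▸ hp)
  have hwK : ∀ᶠ t in atTop, w t ∈ Metric.cthickening 1 (Delta Y) := by
    filter_upwards [hw.tendsto_sub.eventually (Metric.ball_mem_nhds 0 one_pos)] with t ht
    refine Metric.mem_cthickening_of_dist_le _ _ _ _ (hyΔ (N t)) ?_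
    rw [dist_comm, dist_eq_norm]
    simpa using (mem_ball_zero_iff.mp ht).le
  have hK : IsCompact (Metric.cthickening 1 (Delta Y)) := hΔ.cthickening
  refine ⟨⟨?_, ?_⟩, ?_, hLΔ, fun ξ hξ η hη δ hδ T hT => ?_⟩
  · obtain ⟨p, -, φ, hφ, hp⟩ := hΔ.tendsto_subseq hyΔ
    exact ⟨p, φ, hφ, hp⟩
  · rw [hL]
    exact isPreconnected_setOf_mapClusterPt hK hw.lipschitzWith.continuous hwK
  · exact hΔ.of_isClosed_subset (hL ▸ isClosed_setOfPred_clusterPt) hLΔ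
  · rw [hL] at hξ hη
    obtain ⟨k, hk, x, ℓ, hℓ, hx, hjump, hstart, hend⟩ := hw.exists_chain
      (isClosed_perturbedGraph Y u) (convex_perturbedGraph_section Y u) hK hwK hξ hη hδ hT
    exact ⟨k, hk, x, fun _ => ℓ, fun i _ => (hx i).isSolution hLΔ', fun _ _ => hℓ,
      fun i _ s _ _ => hL ▸ (hx i).mapClusterPt s, fun i _ => hjump i, hstart, hend⟩

end ECFP
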